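/- arXiv:2309.12623 — 2 statements merged into one kernel-verified Lean document; each statement's English description precedes it below -/
import Mathlib

section
/- Let ε > 0 and α ≥ 1, and let σ be a valid α-bounded-deletion stream. If m ≥ α/ε, then after Integrated SpaceSaving± with m counters processes σ, every heavy hitter is found: every item x with f(x) > ε·F1 is monitored and its estimate satisfies f̂(x) ≥ f(x) > ε·F1. -/
/-!
Streams of insert/delete operations over a universe `U`, and the
Integrated SpaceSaving± summary, formalized as an association list
`List (U × ℕ × ℕ)` of (item, insert count, delete count) entries.
`true` encodes an insertion, `false` a deletion.
-/

namespace SSPM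

variable {U : Type} [DecidableEq U]

/-- A stream: list of (item, operation) pairs; `true` = insertion, `false` = deletion. -/
abbrev Stream (U : Type) := List (U × Bool)

/-- Number of insertions of `x` in `σ`. -/
def insCount (σ : Stream U) (x : U) : ℕ := σ.countP (fun p => p.1 == x && p.2)

/-- Number of deletions of `x` in `σ`. -/
def delCount (σ : Stream U) (x : U) : ℕ := σ.countP (fun p => p.1 == x && !p.2)

/-- Total number of insertion operations `I`. -/
def totalI (σ : Stream U) : ℕ := σ.countP (fun p => p.2)

/-- Total number of deletion operations `D`. -/
def totalD (σ : Stream U) : ℕ := σ.countP (fun p => !p.2)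

/-- Frequency `f(x) = I(x) - D(x)`. -/
def freq (σ : Stream U) (x : U) : ℤ := (insCount σ x : ℤ) - (delCount σ x : ℤ)

/-- `F1 = I - D`. -/
def F1 (σ : Stream U) : ℤ := (totalI σ : ℤ) - (totalD σ : ℤ)

/-- A stream is valid if in every prefix every item has at least as many
insertions as deletions. -/
def Valid (σ : Stream U) : Prop :=
  ∀ τ : Stream U, τ <+: σ → ∀ x : U, delCount τ x ≤ insCount τ x

/-- `α`-bounded-deletion property: `D ≤ (1 - 1/α) I`. -/
def BoundedDel (α : ℝ) (σ : Stream U) : Prop :=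
  (totalD σ : ℝ) ≤ (1 - 1 / α) * (totalI σ : ℝ)

/-- State of Integrated SpaceSaving±: association list of
(item, insert count, delete count). -/
abbrev ISSState (U : Type) := List (U × ℕ × ℕ)

/-- One step of the Integrated SpaceSaving± update algorithm with `m` counters. -/
def issStep (m : ℕ) (S : ISSState U) (p : U × Bool) : ISSState U :=
  match p with
  | (e, true) =>
    match S.find? (fun q => q.1 == e) with
    | some q => (e, q.2.1 + 1, q.2.2) :: S.eraseP (fun q => q.1 == e)
    | none =>
      if S.length < m then (e, 1, 0) :: S
      else
        match S.argmin (fun q => q.2.1) with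
        | some q => (e, q.2.1 + 1, 0) :: S.eraseP (fun r => r.1 == q.1)
        | none => S
  | (e, false) =>
    match S.find? (fun q => q.1 == e) with
    | some q => (e, q.2.1, q.2.2 + 1) :: S.eraseP (fun q => q.1 == e)
    | none => S

/-- Run Integrated SpaceSaving± with `m` counters on stream `σ`. -/
def issRun (m : ℕ) (σ : Stream U) : ISSState U := σ.foldl (issStep m) []

/-- An item is monitored if it is in the summary. -/
def Monitored (S : ISSState U) (x : U) : Prop := (S.find? (fun q => q.1 == x)).isSome

/-- Query: `f̂(x) = insert_x - delete_x` if `x` is monitored, `0` otherwise. -/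
def issQuery (S : ISSState U) (x : U) : ℤ :=
  match S.find? (fun q => q.1 == x) with
  | some q => (q.2.1 : ℤ) - (q.2.2 : ℤ)
  | none => 0

/-- The insert count of a monitored item (`0` for unmonitored items). -/
def insertCountOf (S : ISSState U) (x : U) : ℕ :=
  match S.find? (fun q => q.1 == x) with
  | some q => q.2.1
  | none => 0

/-- `insert_minItem`: the minimum insert count over monitored items when the
summary is full (has exactly `m` entries), and `0` otherwise. -/
def minInsert (m : ℕ) (S : ISSState U) : ℕ :=
  if S.length = m then
    match S.argmin (fun q => q.2.1) with
    | some q => q.2.1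
    | none => 0
  else 0
lemma freq_nil (x : U) : freq ([] : Stream U) x = 0 := by
  simp [freq, insCount, delCount]

lemma freq_append_ins (σ : Stream U) (e x : U) :
    freq (σ ++ [(e, true)]) x = freq σ x + if e = x then 1 else 0 := by
  by_cases h : e = x <;> (simp [freq, insCount, delCount, List.countP_append, h]; try ring)

lemma freq_append_del (σ : Stream U) (e x : U) :
    freq (σ ++ [(e, false)]) x = freq σ x - if e = x then 1 else 0 := by
  by_cases h : e = x <;> (simp [freq, insCount, delCount, List.countP_append, h]; try ring)

/-- The properties of a summary `S` of `σ` that every update preserves. -/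
structure Invariant (m : ℕ) (σ : Stream U) (S : ISSState U) : Prop where
  nodup_keys : (S.map Prod.fst).Nodup
  length_le : S.length ≤ m
  sum_inserts : (S.map (fun q => q.2.1)).sum = totalI σ
  freq_le_of_mem : ∀ q ∈ S, freq σ q.1 ≤ (q.2.1 : ℤ) - (q.2.2 : ℤ)
  freq_nonpos : ∀ x, x ∉ S.map Prod.fst → S.length < m → freq σ x ≤ 0
  freq_le_insert : ∀ x, x ∉ S.map Prod.fst → ∀ q ∈ S, freq σ x ≤ (q.2.1 : ℤ)

lemma Invariant.perm {m : ℕ} {σ : Stream U} {S T : ISSState U} (h : Invariant m σ S)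
    (p : S.Perm T) : Invariant m σ T where
  nodup_keys := (p.map _).nodup_iff.1 h.nodup_keys
  length_le := p.length_eq ▸ h.length_le
  sum_inserts := ((p.map fun q => q.2.1).sum_eq).symm.trans h.sum_inserts
  freq_le_of_mem q hq := h.freq_le_of_mem q (p.mem_iff.2 hq)
  freq_nonpos x hx hl :=
    h.freq_nonpos x (fun hx' => hx ((p.map _).mem_iff.1 hx')) (p.length_eq ▸ hl)
  freq_le_insert x hx q hq :=
    h.freq_le_insert x (fun hx' => hx ((p.map _).mem_iff.1 hx')) q (p.mem_iff.2 hq)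

lemma perm_cons_eraseP_key {S : ISSState U} (h : (S.map Prod.fst).Nodup) {q : U × ℕ × ℕ}
    (hq : q ∈ S) : S.Perm (q :: S.eraseP (fun r => r.1 == q.1)) := by
  induction S with
  | nil => simp at hq
  | cons a S ih =>
    rw [List.map_cons, List.nodup_cons] at h
    rcases List.mem_cons.1 hq with rfl | hq
    · simp
    · have hne : a.1 ≠ q.1 := fun e => h.1 (e ▸ List.mem_map_of_mem hq)
      rw [List.eraseP_cons_of_neg (by simpa using hne)]
      exact ((ih h.2 hq).cons a).trans (List.Perm.swap _ _ _)

lemma totalI_append_ins {V : Type} (σ : Stream V) (e : V) :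
    totalI (σ ++ [(e, true)]) = totalI σ + 1 := by
  simp [totalI, List.countP_append]

lemma totalI_append_del {V : Type} (σ : Stream V) (e : V) :
    totalI (σ ++ [(e, false)]) = totalI σ := by
  simp [totalI, List.countP_append]

lemma not_mem_keys_of_find?_eq_none {S : ISSState U} {e : U}
    (h : S.find? (fun q => q.1 == e) = none) : e ∉ S.map Prod.fst := by
  simp only [List.find?_eq_none, beq_iff_eq] at h
  simp only [List.mem_map, not_exists, not_and]
  exact h

lemma Invariant.ins_monitored {m : ℕ} {σ : Stream U} {q : U × ℕ × ℕ} {T : ISSState U}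
    (h : Invariant m σ (q :: T)) :
    Invariant m (σ ++ [(q.1, true)]) ((q.1, q.2.1 + 1, q.2.2) :: T) := by
  obtain ⟨h1, h2, h3, h4, h5, h6⟩ := h
  simp only [List.map_cons, List.nodup_cons, List.length_cons, List.sum_cons, List.mem_cons,
    forall_eq_or_imp, not_or] at h1 h2 h3 h4 h5 h6
  refine ⟨by simpa using h1, by simpa using h2, ?_, ?_, ?_, ?_⟩
  · simp only [List.map_cons, List.sum_cons, totalI_append_ins]; omega
  · simp only [List.mem_cons, forall_eq_or_imp, freq_append_ins]
    refine ⟨by push_cast; simp; linarith [h4.1], fun r hr => ?_⟩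
    have : q.1 ≠ r.1 := fun e => h1.1 (e ▸ List.mem_map_of_mem hr)
    simpa [this] using h4.2 r hr
  · simp only [List.map_cons, List.length_cons, List.mem_cons, not_or, freq_append_ins]
    intro x hx hl
    simpa [Ne.symm hx.1] using h5 x hx hl
  · simp only [List.map_cons, List.mem_cons, forall_eq_or_imp, not_or, freq_append_ins]
    intro x hx
    have := h6 x hx
    simp only [Ne.symm hx.1, if_false, add_zero]
    exact ⟨by push_cast; linarith [this.1], this.2⟩

lemma Invariant.ins_new {m : ℕ} {σ : Stream U} {S : ISSState U} (h : Invariant m σ S) {e : U}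
    (he : e ∉ S.map Prod.fst) (hl : S.length < m) :
    Invariant m (σ ++ [(e, true)]) ((e, 1, 0) :: S) := by
  obtain ⟨h1, h2, h3, h4, h5, h6⟩ := h
  refine ⟨by simpa using ⟨by simpa using he, h1⟩, by simpa using hl, ?_, ?_, ?_, ?_⟩
  · simp only [List.map_cons, List.sum_cons, totalI_append_ins]; omega
  · simp only [List.mem_cons, forall_eq_or_imp, freq_append_ins]
    refine ⟨by simpa using h5 e he hl, fun r hr => ?_⟩
    have : e ≠ r.1 := fun e' => he (e' ▸ List.mem_map_of_mem hr)
    simpa [this] using h4 r hr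
  · simp only [List.map_cons, List.mem_cons, not_or, freq_append_ins]
    intro x hx _
    simpa [Ne.symm hx.1] using h5 x hx.2 hl
  · simp only [List.map_cons, List.mem_cons, forall_eq_or_imp, not_or, freq_append_ins]
    intro x hx
    simp only [Ne.symm hx.1, if_false, add_zero]
    exact ⟨by push_cast; linarith [h5 x hx.2 hl], h6 x hx.2⟩

lemma Invariant.ins_replace {m : ℕ} {σ : Stream U} {q : U × ℕ × ℕ} {T : ISSState U}
    (h : Invariant m σ (q :: T)) (hmin : ∀ r ∈ T, q.2.1 ≤ r.2.1) {e : U}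
    (he : e ∉ (q :: T).map Prod.fst) (hl : m ≤ (q :: T).length) :
    Invariant m (σ ++ [(e, true)]) ((e, q.2.1 + 1, 0) :: T) := by
  obtain ⟨h1, h2, h3, h4, h5, h6⟩ := h
  have hmin_e := h6 e he q (by simp)
  simp only [List.map_cons, List.nodup_cons, List.length_cons, List.sum_cons, List.mem_cons,
    forall_eq_or_imp, not_or] at h1 h2 h3 h4 h6 he hl
  refine ⟨by simpa using ⟨by simpa using he.2, h1.2⟩, by simpa using h2, ?_, ?_, ?_, ?_⟩
  · simp only [List.map_cons, List.sum_cons, totalI_append_ins]; omega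
  · simp only [List.mem_cons, forall_eq_or_imp, freq_append_ins]
    refine ⟨by simpa using hmin_e, fun r hr => ?_⟩
    have : e ≠ r.1 := fun e' => he.2 (e' ▸ List.mem_map_of_mem hr)
    simpa [this] using h4.2 r hr
  · simp only [List.length_cons]
    intro x _ hl'
    omega
  · simp only [List.map_cons, List.mem_cons, forall_eq_or_imp, not_or, freq_append_ins]
    intro x hx
    simp only [Ne.symm hx.1, if_false, add_zero]
    have key : freq σ x ≤ (q.2.1 : ℤ) := by
      by_cases hxq : x = q.1
      · subst hxq
        linarith [h4.1]
      · exact (h6 x ⟨hxq, hx.2⟩).1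
    refine ⟨by push_cast; linarith, fun r hr => key.trans ?_⟩
    exact_mod_cast hmin r hr

lemma Invariant.del_monitored {m : ℕ} {σ : Stream U} {q : U × ℕ × ℕ} {T : ISSState U}
    (h : Invariant m σ (q :: T)) :
    Invariant m (σ ++ [(q.1, false)]) ((q.1, q.2.1, q.2.2 + 1) :: T) := by
  obtain ⟨h1, h2, h3, h4, h5, h6⟩ := h
  simp only [List.map_cons, List.nodup_cons, List.length_cons, List.sum_cons, List.mem_cons,
    forall_eq_or_imp, not_or] at h1 h2 h3 h4 h5 h6
  refine ⟨by simpa using h1, by simpa using h2, ?_, ?_, ?_, ?_⟩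
  · simpa only [List.map_cons, List.sum_cons, totalI_append_del] using h3
  · simp only [List.mem_cons, forall_eq_or_imp, freq_append_del]
    refine ⟨by push_cast; simp; linarith [h4.1], fun r hr => ?_⟩
    have : q.1 ≠ r.1 := fun e => h1.1 (e ▸ List.mem_map_of_mem hr)
    simpa [this] using h4.2 r hr
  · simp only [List.map_cons, List.length_cons, List.mem_cons, not_or, freq_append_del]
    intro x hx hl
    simpa [Ne.symm hx.1] using h5 x hx hl
  · simp only [List.map_cons, List.mem_cons, forall_eq_or_imp, not_or, freq_append_del]
    intro x hx
    simpa [Ne.symm hx.1] using h6 x hx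

lemma Invariant.del_unmonitored {m : ℕ} {σ : Stream U} {S : ISSState U} (h : Invariant m σ S)
    (e : U) : Invariant m (σ ++ [(e, false)]) S := by
  have hle : ∀ x, freq (σ ++ [(e, false)]) x ≤ freq σ x := fun x => by
    rw [freq_append_del]; split_ifs <;> omega
  exact ⟨h.nodup_keys, h.length_le, by rw [totalI_append_del, h.sum_inserts],
    fun q hq => (hle _).trans (h.freq_le_of_mem q hq),
    fun x hx hl => (hle x).trans (h.freq_nonpos x hx hl),
    fun x hx q hq => (hle x).trans (h.freq_le_insert x hx q hq)⟩

lemma Invariant.step {m : ℕ} (hm : 0 < m) {σ : Stream U} {S : ISSState U}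
    (h : Invariant m σ S) (p : U × Bool) : Invariant m (σ ++ [p]) (issStep m S p) := by
  obtain ⟨e, _ | _⟩ := p
  · unfold issStep
    dsimp only
    split
    next q hq =>
      obtain rfl : q.1 = e := by simpa using List.find?_some hq
      exact (h.perm (perm_cons_eraseP_key h.nodup_keys (List.mem_of_find?_eq_some hq))).del_monitored
    next => exact h.del_unmonitored e
  · unfold issStep
    dsimp only
    split
    next q hq =>
      obtain rfl : q.1 = e := by simpa using List.find?_some hq
      exact (h.perm (perm_cons_eraseP_key h.nodup_keys (List.mem_of_find?_eq_some hq))).ins_monitored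
    next hnone =>
      have he := not_mem_keys_of_find?_eq_none hnone
      split
      next hl => exact h.ins_new he hl
      next hl =>
        split
        next q hq =>
          have p := perm_cons_eraseP_key h.nodup_keys (List.argmin_mem hq)
          refine (h.perm p).ins_replace (fun r hr => ?_) ?_ ?_
          · exact List.le_of_mem_argmin (f := fun q : U × ℕ × ℕ => q.2.1)
              (List.mem_of_mem_eraseP hr) hq
          · rwa [← (p.map Prod.fst).mem_iff]
          · rw [← p.length_eq]; omega
        next hnil =>
          rw [List.argmin_eq_none] at hnil
          simp [hnil] at hl
          omega

lemma invariant_issRun {m : ℕ} (hm : 0 < m) (σ : Stream U) : Invariant m σ (issRun m σ) := by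
  induction σ using List.reverseRecOn with
  | nil => constructor <;> simp [issRun, totalI, freq_nil]
  | append_singleton σ p ih =>
    have : issRun m (σ ++ [p]) = issStep m (issRun m σ) p := by simp [issRun]
    rw [this]
    exact ih.step hm p

/-- An unmonitored item has frequency at most `I / m`. -/
lemma Invariant.mul_freq_le {m : ℕ} {σ : Stream U} {S : ISSState U} (h : Invariant m σ S)
    {x : U} (hx : x ∉ S.map Prod.fst) : (m : ℤ) * freq σ x ≤ totalI σ := by
  rcases h.length_le.lt_or_eq with hl | hl
  · have := h.freq_nonpos x hx hl
    nlinarith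
  · have := List.card_nsmul_le_sum (S.map (fun q => (q.2.1 : ℤ))) (freq σ x)
      (by
        intro y hy
        obtain ⟨q, hq, rfl⟩ := List.mem_map.1 hy
        exact h.freq_le_insert x hx q hq)
    rw [← h.sum_inserts, ← hl]
    simpa [Nat.cast_list_sum, Function.comp_def] using this

/-- Let ε > 0, α ≥ 1, and σ a valid α-bounded-deletion stream.
If m ≥ α/ε, then after Integrated SpaceSaving± with m counters processes σ,
every heavy hitter is found: every item x with f(x) > ε·F1 is monitored and
its estimate satisfies f̂(x) ≥ f(x) > ε·F1. -/
theorem iss_heavy_hitters (ε α : ℝ) (hε : 0 < ε) (hα : 1 ≤ α)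
    (σ : Stream U) (hv : Valid σ) (hb : BoundedDel α σ)
    (m : ℕ) (hm : α / ε ≤ (m : ℝ)) (x : U)
    (hx : ε * (F1 σ : ℝ) < (freq σ x : ℝ)) :
    Monitored (issRun m σ) x ∧
      (freq σ x : ℝ) ≤ (issQuery (issRun m σ) x : ℝ) ∧
      ε * (F1 σ : ℝ) < (issQuery (issRun m σ) x : ℝ) := by
  have hα0 : 0 < α := by linarith
  have hm0 : (0 : ℝ) < m := (div_pos hα0 hε).trans_le hm
  have h := invariant_issRun (by exact_mod_cast hm0) σ
  have hF : (totalI σ : ℝ) ≤ α * F1 σ := by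
    unfold BoundedDel at hb
    have h1 := mul_le_mul_of_nonneg_left hb hα0.le
    have h2 : α * ((1 - 1 / α) * (totalI σ : ℝ)) = α * totalI σ - totalI σ := by
      field_simp
    simp only [F1]
    push_cast
    linarith
  cases hfind : (issRun m σ).find? (fun q => q.1 == x) with
  | none =>
    exfalso
    have h1 : (m : ℝ) * freq σ x ≤ totalI σ := by
      exact_mod_cast h.mul_freq_le (not_mem_keys_of_find?_eq_none hfind)
    have hF0 : (0 : ℝ) ≤ F1 σ := by
      have : (0 : ℝ) ≤ α * F1 σ := (Nat.cast_nonneg _).trans hF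
      exact nonneg_of_mul_nonneg_right this hα0
    have h2 : α ≤ m * ε := (div_le_iff₀ hε).1 hm
    have h3 := mul_lt_mul_of_pos_left hx hm0
    have h4 := mul_le_mul_of_nonneg_right h2 hF0
    linarith
  | some q =>
    obtain rfl : q.1 = x := by simpa using List.find?_some hfind
    have hle : (freq σ q.1 : ℝ) ≤ (issQuery (issRun m σ) q.1 : ℝ) := by
      simp only [issQuery, hfind]
      exact_mod_cast h.freq_le_of_mem q (List.mem_of_find?_eq_some hfind)
    exact ⟨by simp [Monitored, hfind], hle, hx.trans_le hle⟩

end SSPM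
end

section
/- Let ε > 0 and α ≥ 1, and let σ be a valid α-bounded-deletion stream. If m_I ≥ 2α/ε, m_D ≥ 2(α−1)/ε and m_I, m_D ≥ 1, then after Double SpaceSaving± with (m_I, m_D) counters processes σ, every heavy hitter is monitored in S_insert: every item x with f(x) > ε·F1 is in the map of S_insert. -/
/-!
Streams of insert/delete operations over a universe `U`, the insertion-only
SpaceSaving summary (association list `List (U × ℕ)` of (item, count) entries),
and the Double SpaceSaving± algorithm, which runs one SpaceSaving summary on
the inserted items and one on the deleted items. `true` encodes an insertion,
`false` a deletion.
-/

namespace SSPM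

variable {U : Type} [DecidableEq U]

/-- State of SpaceSaving: association list of (item, count). -/
abbrev SSState (U : Type) := List (U × ℕ)

/-- One step of the (insertion-only) SpaceSaving update algorithm with `m` counters. -/
def ssStep (m : ℕ) (S : SSState U) (e : U) : SSState U :=
  match S.find? (fun q => q.1 == e) with
  | some q => (e, q.2 + 1) :: S.eraseP (fun q => q.1 == e)
  | none =>
    if S.length < m then (e, 1) :: S
    else
      match S.argmin (fun q => q.2) with
      | some q => (e, q.2 + 1) :: S.eraseP (fun r => r.1 == q.1)
      | none => S

/-- Run SpaceSaving with `m` counters on a list of items. -/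
def ssRun (m : ℕ) (l : List U) : SSState U := l.foldl (ssStep m) []

/-- Query `Ŝ(x)`: the count of `x` if monitored, `0` otherwise. -/
def ssQuery (S : SSState U) (x : U) : ℕ :=
  match S.find? (fun q => q.1 == x) with
  | some q => q.2
  | none => 0

/-- The subsequence of items inserted in `σ`. -/
def insSeq (σ : Stream U) : List U := (σ.filter (fun p => p.2)).map Prod.fst

/-- The subsequence of items deleted in `σ`. -/
def delSeq (σ : Stream U) : List U := (σ.filter (fun p => !p.2)).map Prod.fst

/-- Double SpaceSaving± query:
`f̂(x) = max(Ŝ_insert(x) − Ŝ_delete(x), 0)` where `S_insert = ssRun mI (insSeq σ)`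
and `S_delete = ssRun mD (delSeq σ)`. -/
def dssQuery (mI mD : ℕ) (σ : Stream U) (x : U) : ℤ :=
  max ((ssQuery (ssRun mI (insSeq σ)) x : ℤ) - (ssQuery (ssRun mD (delSeq σ)) x : ℤ)) 0
/-- The invariant satisfied by the SpaceSaving state `S` with `m` counters after processing `l`:
counts of monitored items are overestimates, and an item that is not monitored either never occurred
or has been evicted from a full summary, all of whose counts bound its frequency. -/
structure IsSummary (m : ℕ) (l : List U) (S : SSState U) : Prop where
  nodup : (S.map Prod.fst).Nodup
  sum_eq : (S.map Prod.snd).sum = l.length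
  length_le : S.length ≤ m
  count_le : ∀ q ∈ S, l.count q.1 ≤ q.2
  not_mem : ∀ x, x ∉ S.map Prod.fst →
    l.count x = 0 ∨ (S.length = m ∧ ∀ q ∈ S, l.count x ≤ q.2)

theorem IsSummary.perm {m : ℕ} {l : List U} {S T : SSState U} (h : IsSummary m l S)
    (hp : S.Perm T) : IsSummary m l T where
  nodup := (hp.map _).nodup_iff.1 h.nodup
  sum_eq := (hp.map Prod.snd).sum_eq.symm.trans h.sum_eq
  length_le := hp.length_eq ▸ h.length_le
  count_le q hq := h.count_le q (hp.mem_iff.2 hq)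
  not_mem x hx := by
    have := h.not_mem x (fun hm => hx ((hp.map _).mem_iff.1 hm))
    simpa only [hp.length_eq, hp.mem_iff] using this

theorem perm_cons_eraseP_fst {S : SSState U} (h : (S.map Prod.fst).Nodup) {q : U × ℕ}
    (hq : q ∈ S) : S.Perm (q :: S.eraseP (fun r => r.1 == q.1)) := by
  obtain ⟨a, l₁, l₂, -, ha, rfl, he⟩ :=
    List.exists_of_eraseP (p := fun r : U × ℕ => r.1 == q.1) hq (by simp)
  have : a = q := List.inj_on_of_nodup_map h (by simp) hq (by simpa using ha)
  subst this
  rw [he]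
  exact List.perm_middle

theorem IsSummary.ssStep {m : ℕ} (hm : 1 ≤ m) {l : List U} {S : SSState U}
    (h : IsSummary m l S) (e : U) : IsSummary m (l ++ [e]) (ssStep m S e) := by
  unfold SSPM.ssStep
  split
  · rename_i q hq
    have hqe : q.1 = e := by simpa using List.find?_some hq
    subst hqe
    have h' := h.perm (perm_cons_eraseP_fst h.nodup (List.mem_of_find?_eq_some hq))
    generalize S.eraseP (fun r => r.1 == q.1) = T at h'
    obtain ⟨h1, h2, h3, h4, h5⟩ := h'
    refine ⟨by simpa using h1, ?_, by simpa using h3, ?_, ?_⟩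
    · simp at h2 ⊢; omega
    · intro r hr
      rcases List.mem_cons.1 hr with rfl | hr
      · have := h4 q (by simp)
        simpa using this
      · have := h4 r (by simp [hr])
        have hne : q.1 ≠ r.1 := by
          rintro heq
          simp only [List.map_cons, List.nodup_cons] at h1
          exact h1.1 (heq ▸ List.mem_map_of_mem hr)
        simpa [List.count_cons, hne] using this
    · intro x hx
      have hne : q.1 ≠ x := by rintro rfl; simp at hx
      have := h5 x (by simpa using hx)
      simp only [List.count_append, List.count_singleton, List.length_cons,
        List.forall_mem_cons, beq_iff_eq, hne, if_false, add_zero] at this ⊢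
      exact this.imp_right fun ⟨a, b, c⟩ => ⟨a, by omega, c⟩
  · rename_i hnone
    have he : e ∉ S.map Prod.fst := by
      rw [List.find?_eq_none] at hnone
      simpa using fun c hc => hnone (e, c) hc (by simp)
    split
    · rename_i hlt
      have hzero : ∀ x, x ∉ S.map Prod.fst → l.count x = 0 := fun x hx =>
        (h.not_mem x hx).resolve_right fun hc => hlt.ne hc.1
      refine ⟨List.nodup_cons.2 ⟨he, h.nodup⟩, ?_, by simpa using hlt, ?_, ?_⟩
      · have := h.sum_eq
        simp at this ⊢; omega
      · intro r hr
        rcases List.mem_cons.1 hr with rfl | hr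
        · simp [hzero e he]
        · have hne : e ≠ r.1 := fun heq => he (heq ▸ List.mem_map_of_mem hr)
          simpa [List.count_cons, hne] using h.count_le r hr
      · intro x hx
        rw [List.map_cons, List.mem_cons, not_or] at hx
        left
        simp [hzero x hx.2, Ne.symm hx.1]
    · rename_i hlt
      have hlen : S.length = m := le_antisymm h.length_le (not_lt.1 hlt)
      split
      · rename_i q hq
        have hqS : q ∈ S := List.argmin_mem hq
        have hmin : ∀ r ∈ S, q.2 ≤ r.2 := fun r hr => List.le_of_mem_argmin hr hq
        have hp := perm_cons_eraseP_fst h.nodup hqS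
        have h' := h.perm hp
        have he' := mt (hp.map Prod.fst).mem_iff.2 he
        have hlen' := hp.length_eq.symm.trans hlen
        replace hmin := fun r hr => hmin r (hp.mem_iff.2 hr)
        generalize S.eraseP (fun r => r.1 == q.1) = T at h' he' hlen' hmin
        obtain ⟨h1, h2, h3, h4, h5⟩ := h'
        have hbound : ∀ x, x ∉ T.map Prod.fst → l.count x ≤ q.2 := by
          intro x hx
          by_cases hxq : x = q.1
          · exact hxq ▸ h4 q (by simp)
          · rcases h5 x (by simpa [hxq] using hx) with h0 | ⟨-, hle⟩
            · omega
            · exact hle q (by simp)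
        rw [List.map_cons, List.mem_cons, not_or] at he'
        rw [List.map_cons, List.nodup_cons] at h1
        refine ⟨List.nodup_cons.2 ⟨he'.2, h1.2⟩, ?_, by simpa using h3, ?_, ?_⟩
        · simp at h2 ⊢; omega
        · intro r hr
          rcases List.mem_cons.1 hr with rfl | hr
          · simpa using hbound e he'.2
          · have hne : e ≠ r.1 := fun heq => he'.2 (heq ▸ List.mem_map_of_mem hr)
            simpa [List.count_cons, hne] using h4 r (by simp [hr])
        · intro x hx
          rw [List.map_cons, List.mem_cons, not_or] at hx
          have hb := hbound x hx.2
          refine Or.inr ⟨by simpa using hlen', ?_⟩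
          have hc : (l ++ [e]).count x = l.count x := by
            simp [Ne.symm hx.1]
          rw [hc, List.forall_mem_cons]
          exact ⟨by simp only; omega, fun r hr => hb.trans (hmin r (by simp [hr]))⟩
      · rename_i hnil
        rw [List.argmin_eq_none] at hnil
        subst hnil
        simp at hlen
        omega

theorem isSummary_ssRun {m : ℕ} (hm : 1 ≤ m) (l : List U) : IsSummary m l (ssRun m l) := by
  induction l using List.reverseRecOn with
  | nil => exact ⟨by simp [ssRun], by simp [ssRun], by simp [ssRun], by simp [ssRun], by simp⟩
  | append_singleton l e ih =>
    rw [ssRun, List.foldl_append]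
    exact ih.ssStep hm e

/-- An item that is not monitored occurs in at most a `1 / m` fraction of the input. -/
theorem mul_count_le_length_of_not_monitored {m : ℕ} (hm : 1 ≤ m) (l : List U) {x : U}
    (hx : x ∉ (ssRun m l).map Prod.fst) : m * l.count x ≤ l.length := by
  have h := isSummary_ssRun hm l
  rcases h.not_mem x hx with h0 | ⟨hlen, hle⟩
  · simp [h0]
  · have := List.card_nsmul_le_sum ((ssRun m l).map Prod.snd) (l.count x) (by
      intro c hc
      obtain ⟨q, hq, rfl⟩ := List.mem_map.1 hc
      exact hle q hq)
    simpa [hlen, h.sum_eq] using this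

theorem length_insSeq {V : Type} (σ : Stream V) : (insSeq σ).length = totalI σ := by
  simp [insSeq, totalI, List.countP_eq_length_filter]

theorem count_insSeq (σ : Stream U) (x : U) : (insSeq σ).count x = insCount σ x := by
  simp only [insSeq, insCount, List.count, List.countP_map, List.countP_filter]
  rfl

/-- Let ε > 0, α ≥ 1, and σ a valid α-bounded-deletion stream.
If m_I ≥ 2α/ε, m_D ≥ 2(α−1)/ε and m_I, m_D ≥ 1, then after Double SpaceSaving±
with (m_I, m_D) counters processes σ, every heavy hitter is monitored in
S_insert: every item x with f(x) > ε·F1 is in the map of S_insert. -/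
theorem dss_heavy_hitters_monitored (ε α : ℝ) (hε : 0 < ε) (hα : 1 ≤ α)
    (σ : Stream U) (hv : Valid σ) (hb : BoundedDel α σ)
    (mI mD : ℕ) (hmI1 : 1 ≤ mI) (hmD1 : 1 ≤ mD)
    (hmI : 2 * α / ε ≤ (mI : ℝ)) (hmD : 2 * (α - 1) / ε ≤ (mD : ℝ))
    (x : U) (hx : ε * (F1 σ : ℝ) < (freq σ x : ℝ)) :
    ((ssRun mI (insSeq σ)).find? (fun q => q.1 == x)).isSome := by
  by_contra hc
  have hx' : x ∉ (ssRun mI (insSeq σ)).map Prod.fst := by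
    simpa [List.find?_isSome] using hc
  have hle := mul_count_le_length_of_not_monitored hmI1 (insSeq σ) hx'
  rw [length_insSeq, count_insSeq] at hle
  have hle' : (mI : ℝ) * insCount σ x ≤ totalI σ := by exact_mod_cast hle
  have hα0 : 0 < α := by linarith
  have hF : (totalI σ : ℝ) ≤ α * F1 σ := by
    have hb' : (totalD σ : ℝ) ≤ (1 - 1 / α) * totalI σ := hb
    have h1 := mul_le_mul_of_nonneg_left hb' hα0.le
    have h2 : α * ((1 - 1 / α) * (totalI σ : ℝ)) = α * totalI σ - totalI σ := by
      field_simp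
    simp only [F1, Int.cast_sub, Int.cast_natCast]
    linarith
  have hf : ε * (F1 σ : ℝ) < insCount σ x := by
    have : (freq σ x : ℝ) ≤ insCount σ x := by
      simp [freq]
    linarith
  have hm : 2 * α ≤ mI * ε := (div_le_iff₀ hε).1 hmI
  have hmpos : (0 : ℝ) < mI := by exact_mod_cast hmI1
  have h1 : (mI : ℝ) * (ε * F1 σ) < totalI σ := (mul_lt_mul_of_pos_left hf hmpos).trans_le hle'
  have hI : (0 : ℝ) ≤ totalI σ := Nat.cast_nonneg _
  have hF0 : (0 : ℝ) ≤ F1 σ := by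
    by_contra hneg
    nlinarith
  have h2 := mul_le_mul_of_nonneg_right hm hF0
  nlinarith

end SSPM
end
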